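/- Modes of the strongly ferromagnetic Ising model, part 2 (mode bijection): Let p_G be the Ising distribution on {−1,1}^N with clique C_G and fields h, let h_G := Σ_{i∈C_G} h_i, and let R₁, R₋₁ be as below. Then the map f: R₁ → R₋₁ defined by f(x)_i = −1 for i ∈ C_G and f(x)_i = x_i for i ∉ C_G is a bijection, and for every x ∈ R₁, p_G(x) = e^{2 h_G} p_G(f(x)). -/

import Mathlib

open scoped Classical BigOperators

noncomputable section

/-- The spin value of a Boolean: `true ↦ 1`, `false ↦ -1`. -/
def spin (b : Bool) : ℝ := if b then 1 else -1

/-- The energy (negative Hamiltonian) of the Ising model with clique `C`, coupling `J`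
(counted once per unordered pair of distinct clique vertices) and fields `h`. -/
def isingEnergy {N : ℕ} (C : Finset (Fin N)) (J : ℝ) (h : Fin N → ℝ)
    (x : Fin N → Bool) : ℝ :=
  (∑ i, h i * spin (x i))
    + ∑ i ∈ C, ∑ j ∈ C, (if i < j then J * spin (x i) * spin (x j) else 0)

/-- The Ising distribution `p_G` with clique `C`, coupling `J` and fields `h`. -/
def isingP {N : ℕ} (C : Finset (Fin N)) (J : ℝ) (h : Fin N → ℝ)
    (x : Fin N → Bool) : ℝ :=
  Real.exp (isingEnergy C J h x) / ∑ y : Fin N → Bool, Real.exp (isingEnergy C J h y)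

/-- **Modes of the strongly ferromagnetic Ising model, part 2 (mode bijection).**
The map that sets all clique spins to `-1` (and keeps the other coordinates) is a
bijection from `R₁` (all clique spins `+1`) onto `R₋₁` (all clique spins `-1`), and for
every `x ∈ R₁`, `p_G(x) = e^{2 h_G} p_G(f(x))` where `h_G = Σ_{i∈C} h_i`. -/
theorem ising_mode_bijection
    {N : ℕ} (C : Finset (Fin N)) (hC : 2 ≤ C.card)
    (J : ℝ) (hJ : 0 < J) (h : Fin N → ℝ)
    (f : (Fin N → Bool) → (Fin N → Bool))
    (hf : ∀ x i, f x i = if i ∈ C then false else x i) :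
    Set.BijOn f
      {x : Fin N → Bool | ∀ i ∈ C, x i = true}
      {x : Fin N → Bool | ∀ i ∈ C, x i = false}
    ∧ ∀ x : Fin N → Bool, (∀ i ∈ C, x i = true) →
        isingP C J h x = Real.exp (2 * ∑ i ∈ C, h i) * isingP C J h (f x) := by
  refine ⟨⟨?_, ?_, ?_⟩, ?_⟩
  · intro x _ i hi
    simp [hf, hi]
  · intro x hx y hy hxy
    funext i
    by_cases hi : i ∈ C
    · rw [hx i hi, hy i hi]
    · have := congrFun hxy i
      simpa [hf, hi] using this
  · intro y hy
    refine ⟨fun i => if i ∈ C then true else y i, ?_, ?_⟩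
    · intro i hi
      simp [hi]
    · funext i
      by_cases hi : i ∈ C
      · simp [hf, hi, hy i hi]
      · simp [hf, hi]
  · intro x hx
    have key : isingEnergy C J h x = 2 * ∑ i ∈ C, h i + isingEnergy C J h (f x) := by
      have h1 : ∑ i, h i * spin (x i) = 2 * ∑ i ∈ C, h i + ∑ i, h i * spin (f x i) := by
        have e : ∑ i ∈ C, h i = ∑ i, if i ∈ C then h i else 0 := by simp
        rw [e, Finset.mul_sum, ← Finset.sum_add_distrib]
        refine Finset.sum_congr rfl fun i _ => ?_
        by_cases hi : i ∈ C
        · simp [hf, hi, hx i hi, spin]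
          ring
        · simp [hf, hi]
      have h2 : (∑ i ∈ C, ∑ j ∈ C, (if i < j then J * spin (x i) * spin (x j) else 0))
          = ∑ i ∈ C, ∑ j ∈ C, (if i < j then J * spin (f x i) * spin (f x j) else 0) := by
        refine Finset.sum_congr rfl fun i hi => Finset.sum_congr rfl fun j hj => ?_
        simp [hf, hi, hj, hx i hi, hx j hj, spin]
      unfold isingEnergy
      rw [h1, h2]
      ring
    unfold isingP
    rw [key, Real.exp_add, mul_div_assoc]
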